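/- Let (L, d, [,]) be a DGLA over a field of characteristic 0 with a decomposition L = M ⊕ C ⊕ D as graded vector spaces, where M is a differential graded Lie subalgebra of L and d restricts to an isomorphism of graded vector spaces C → D[1]. Then for every local Artinian K-algebra A with residue field K, the map α: MC_M(A) × (C⁰ ⊗ 𝔪_A) → MC_L(A), (x, c) ↦ e^c ∗ x, is a bijection. -/

import Mathlib

/-- A (ℤ-graded) differential graded Lie algebra over a field `K`,
presented via an internally graded module: an ambient module `V`,
a grading by submodules, a degree‑1 differential and a bilinear bracket,
with the graded axioms imposed on homogeneous elements. -/
structure DGLA (K : Type) [Field K] where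
  V : Type
  [acg : AddCommGroup V]
  [mod : Module K V]
  grading : ℤ → Submodule K V
  isInternal : DirectSum.IsInternal grading
  d : V →ₗ[K] V
  bracket : V →ₗ[K] V →ₗ[K] V
  d_mem : ∀ (i : ℤ) (v : V), v ∈ grading i → d v ∈ grading (i + 1)
  bracket_mem : ∀ (i j : ℤ) (v w : V), v ∈ grading i → w ∈ grading j →
    bracket v w ∈ grading (i + j)
  d_sq : ∀ v, d (d v) = 0
  antisymm : ∀ (i j : ℤ) (v w : V), v ∈ grading i → w ∈ grading j →
    bracket v w = -(((-1 : K) ^ (i * j)) • bracket w v)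
  jacobi : ∀ (i j : ℤ) (v w u : V), v ∈ grading i → w ∈ grading j →
    bracket v (bracket w u) =
      bracket (bracket v w) u + ((-1 : K) ^ (i * j)) • bracket w (bracket v u)
  leibniz : ∀ (i : ℤ) (v w : V), v ∈ grading i →
    d (bracket v w) = bracket (d v) w + ((-1 : K) ^ i) • bracket v (d w)

attribute [instance] DGLA.acg DGLA.mod

/-- A morphism of differential graded Lie algebras. -/
structure DGLAHom {K : Type} [Field K] (L M : DGLA K) where
  toLin : L.V →ₗ[K] M.V
  map_grading : ∀ (i : ℤ) (v : L.V), v ∈ L.grading i → toLin v ∈ M.grading i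
  map_d : ∀ v, toLin (L.d v) = M.d (toLin v)
  map_bracket : ∀ v w, toLin (L.bracket v w) = M.bracket (toLin v) (toLin w)

open scoped TensorProduct

section Artin

variable {K : Type} [Field K] {A : Type} [CommRing A] [Algebra K A]

/-- Multiplication of an ideal `m ⊆ A`, as a `K`-bilinear map `m × m → m`. -/
noncomputable def idealMul (m : Ideal A) : ↥m →ₗ[K] ↥m →ₗ[K] ↥m :=
  LinearMap.mk₂ K (fun a b => ⟨a.1 * b.1, Ideal.mul_mem_left m a.1 b.2⟩)
    (by intro a a' b; apply Subtype.ext; simp [add_mul])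
    (by intro c a b; apply Subtype.ext; simp [smul_mul_assoc])
    (by intro a b b'; apply Subtype.ext; simp [mul_add])
    (by intro c a b; apply Subtype.ext; simp [mul_smul_comm])

variable (L : DGLA K) (m : Ideal A)

/-- The nilpotent DGLA `L ⊗ 𝔪_A`. -/
abbrev TmA : Type := L.V ⊗[K] ↥m

/-- The differential of `L ⊗ 𝔪_A`. -/
noncomputable def dTm : TmA L m →ₗ[K] TmA L m := LinearMap.rTensor (↥m) L.d

/-- The bracket of `L ⊗ 𝔪_A`: `[x⊗a, y⊗b] = [x,y] ⊗ ab`. -/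
noncomputable def brTm : TmA L m →ₗ[K] TmA L m →ₗ[K] TmA L m :=
  TensorProduct.map₂ L.bracket (idealMul m)

/-- `S ⊗ 𝔪_A` inside `L ⊗ 𝔪_A`, for a subspace `S ⊆ L`. -/
noncomputable def subTm (S : Submodule K L.V) : Submodule K (TmA L m) :=
  LinearMap.range (TensorProduct.map S.subtype (LinearMap.id (R := K) (M := ↥m)))

/-- The Maurer–Cartan equation `dx + ½[x,x] = 0` in `L ⊗ 𝔪_A`. -/
noncomputable def MCeq (x : TmA L m) : Prop :=
  dTm L m x + (2⁻¹ : K) • brTm L m x x = 0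

/-- The gauge action `e^a ∗ y = y + Σ_n ad_a^n/(n+1)!([a,y] − da)` in `L ⊗ 𝔪_A`;
since `𝔪_A^nN = 0` the series is finite and is written as a sum over `n < nN`. -/
noncomputable def gaugeTm (nN : ℕ) (a y : TmA L m) : TmA L m :=
  y + ∑ n ∈ Finset.range nN,
    ((Nat.factorial (n + 1) : K))⁻¹ •
      ((brTm L m a : TmA L m →ₗ[K] TmA L m) ^ n) (brTm L m a y - dTm L m a)

end Artin

section Exponential

variable {K P W : Type*} [Field K] [CharZero K] [AddCommGroup P] [Module K P]
  [AddCommGroup W] [Module K W]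

/-- If `T` is compatible with the bilinear map `B` through the derivation `N`, then `exp T`
intertwines `B` with `exp N`; as `exp T` is injective, `B` vanishes at `(p, p)` as soon as it
vanishes at `(exp N p, exp N p)`. -/
theorem bilin_eq_zero_of_exp_eq_zero (B : P →ₗ[K] P →ₗ[K] W) (N : Module.End K P)
    (T : Module.End K W) (hB : ∀ p q, T (B p q) = B (N p) q + B p (N q)) (n : ℕ)
    (hN : N ^ n = 0) (hT : T ^ n = 0) (p : P)
    (h : B (∑ i ∈ Finset.range n, ((Nat.factorial i : K))⁻¹ • (N ^ i) p)
      (∑ i ∈ Finset.range n, ((Nat.factorial i : K))⁻¹ • (N ^ i) p) = 0) :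
    B p p = 0 := by
  let _ : Module ℚ P := Module.compHom P (algebraMap ℚ K)
  let _ : Module ℚ W := Module.compHom W (algebraMap ℚ K)
  have hexp : ∑ i ∈ Finset.range n, ((Nat.factorial i : K))⁻¹ • (N ^ i) p
      = IsNilpotent.exp N p := by
    rw [IsNilpotent.exp_eq_sum hN, LinearMap.sum_apply]
    refine Finset.sum_congr rfl fun i _ => ?_
    rw [LinearMap.smul_apply]
    exact inv_natCast_smul_eq K ℚ _ _
  rw [hexp] at h
  have hNn : IsNilpotent N := ⟨n, hN⟩
  have hTn : IsNilpotent T := ⟨n, hT⟩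
  let NL : Module.End K (P ⊗[K] P) := N.lTensor P
  let NR : Module.End K (P ⊗[K] P) := N.rTensor P
  have hNL : IsNilpotent NL := ⟨n, by simp [NL, LinearMap.lTensor_pow, hN]⟩
  have hNR : IsNilpotent NR := ⟨n, by simp [NR, LinearMap.rTensor_pow, hN]⟩
  have hcomm : Commute NL NR := by ext; simp [NL, NR]
  have hl : IsNilpotent.exp NL = (IsNilpotent.exp N).lTensor P :=
    (IsNilpotent.map_exp hNn (Module.End.lTensorAlgHom K P P)).symm
  have hr : IsNilpotent.exp NR = (IsNilpotent.exp N).rTensor P :=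
    (IsNilpotent.map_exp hNn (Module.End.rTensorAlgHom K P P)).symm
  have key := Module.End.commute_exp_left_of_commute (fM := NL + NR) (fN := T)
    (g := TensorProduct.lift B) (hcomm.isNilpotent_add hNL hNR) hTn
    (by ext p q; simp [NL, NR, hB, add_comm])
  have key' := LinearMap.congr_fun key (p ⊗ₜ p)
  rw [IsNilpotent.exp_add_of_commute hcomm hNL hNR, hl, hr] at key'
  simp only [LinearMap.comp_apply, TensorProduct.lift.tmul, Module.End.mul_apply,
    LinearMap.rTensor_tmul, LinearMap.lTensor_tmul, h] at key'
  have hinv := LinearMap.congr_fun (IsNilpotent.exp_neg_mul_exp_self hTn) (B p p)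
  simpa [key'] using hinv.symm

end Exponential

/-- For a linear endomorphism `d` injective on `C'`, with `d C'` independent of `M ⊕ C`,
there is a projection onto `d C'` followed by the inverse of `d`. -/
theorem exists_contraction {K V : Type*} [Field K] [AddCommGroup V] [Module K V]
    (d : V →ₗ[K] V) (M C C' : Submodule K V)
    (h : ∀ x ∈ M, ∀ c ∈ C, ∀ c' ∈ C', x + c + d c' = 0 → x = 0 ∧ c = 0 ∧ c' = 0) :
    ∃ s : V →ₗ[K] V, (∀ x ∈ M, s x = 0) ∧ (∀ c ∈ C, s c = 0) ∧ ∀ c ∈ C', s (d c) = c := by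
  let f : (M × C) × C' →ₗ[K] V :=
    LinearMap.coprod (LinearMap.coprod M.subtype C.subtype) (d ∘ₗ C'.subtype)
  have hf : LinearMap.ker f = ⊥ := by
    rw [LinearMap.ker_eq_bot']
    rintro ⟨⟨x, c⟩, c'⟩ he
    obtain ⟨h1, h2, h3⟩ := h x x.2 c c.2 c' c'.2 (by simpa [f] using he)
    exact Prod.ext (Prod.ext (Subtype.ext h1) (Subtype.ext h2)) (Subtype.ext h3)
  obtain ⟨g, hg⟩ := f.exists_leftInverse_of_injective hf
  have hg' : ∀ t, g (f t) = t := fun t => LinearMap.congr_fun hg t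
  refine ⟨C'.subtype ∘ₗ LinearMap.snd K _ _ ∘ₗ g, fun x hx => ?_, fun c hc => ?_, fun c hc => ?_⟩
  · have := hg' ((⟨x, hx⟩, 0), 0)
    simp [f] at this
    simp [this]
  · have := hg' ((0, ⟨c, hc⟩), 0)
    simp [f] at this
    simp [this]
  · have := hg' ((0, 0), ⟨c, hc⟩)
    simp [f] at this
    simp [this]

section Filtration

variable {K : Type} [Field K] {A : Type} [CommRing A] [Algebra K A]
variable (L : DGLA K) (m : Ideal A)

/-- The subspace `S ⊗ 𝔪^k` of `L ⊗ 𝔪`. -/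
def filt (S : Submodule K L.V) (k : ℕ) : Submodule K (TmA L m) :=
  Submodule.span K {t | ∃ s ∈ S, ∃ μ : m, (μ : A) ∈ m ^ k ∧ s ⊗ₜ[K] μ = t}

variable {L m}

theorem tmul_mem_filt {S : Submodule K L.V} {k : ℕ} {s : L.V} (hs : s ∈ S) {μ : m}
    (hμ : (μ : A) ∈ m ^ k) : (s ⊗ₜ[K] μ : TmA L m) ∈ filt L m S k :=
  Submodule.subset_span ⟨s, hs, μ, hμ, rfl⟩

theorem filt_le_iff {S : Submodule K L.V} {k : ℕ} {p : Submodule K (TmA L m)} :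
    filt L m S k ≤ p ↔ ∀ s ∈ S, ∀ μ : m, (μ : A) ∈ m ^ k → s ⊗ₜ[K] μ ∈ p := by
  rw [filt, Submodule.span_le]
  constructor
  · exact fun h s hs μ hμ => h ⟨s, hs, μ, hμ, rfl⟩
  · rintro h _ ⟨s, hs, μ, hμ, rfl⟩
    exact h s hs μ hμ

theorem subTm_eq_filt (S : Submodule K L.V) : subTm L m S = filt L m S 1 := by
  apply le_antisymm
  · rintro _ ⟨t, rfl⟩
    induction t using TensorProduct.induction_on with
    | zero => simp
    | tmul s μ => exact tmul_mem_filt s.2 (by simp)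
    | add x y hx hy => rw [map_add]; exact add_mem hx hy
  · rw [filt_le_iff]
    exact fun s hs μ _ => ⟨⟨s, hs⟩ ⊗ₜ μ, rfl⟩

theorem filt_top_one : filt L m ⊤ 1 = ⊤ := by
  rw [eq_top_iff]
  rintro t -
  induction t using TensorProduct.induction_on with
  | zero => simp
  | tmul s μ => exact tmul_mem_filt Submodule.mem_top (by simp)
  | add x y hx hy => exact add_mem hx hy

theorem filt_mono {S T : Submodule K L.V} (h : S ≤ T) {k l : ℕ} (hkl : l ≤ k) :
    filt L m S k ≤ filt L m T l :=
  filt_le_iff.2 fun _ hs _ hμ => tmul_mem_filt (h hs) (Ideal.pow_le_pow_right hkl hμ)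

theorem filt_eq_bot {k : ℕ} (hm : m ^ k = ⊥) (S : Submodule K L.V) : filt L m S k = ⊥ := by
  rw [eq_bot_iff, filt_le_iff]
  intro s hs μ hμ
  have : μ = 0 := by
    ext
    simpa [hm] using hμ
  simp [this]

theorem rTensor_mem_filt {S T : Submodule K L.V} {f : L.V →ₗ[K] L.V} (h : ∀ v ∈ S, f v ∈ T)
    {k : ℕ} {x : TmA L m} (hx : x ∈ filt L m S k) : f.rTensor m x ∈ filt L m T k := by
  have : filt L m S k ≤ (filt L m T k).comap (f.rTensor m) :=
    filt_le_iff.2 fun s hs μ hμ => tmul_mem_filt (h s hs) hμ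
  exact this hx

theorem brTm_tmul (v w : L.V) (μ ν : m) :
    brTm L m (v ⊗ₜ μ) (w ⊗ₜ ν) = L.bracket v w ⊗ₜ[K] idealMul (K := K) m μ ν := rfl

theorem dTm_tmul (v : L.V) (μ : m) : dTm L m (v ⊗ₜ μ) = L.d v ⊗ₜ[K] μ := rfl

theorem brTm_mem_filt {S T U : Submodule K L.V} (h : ∀ v ∈ S, ∀ w ∈ T, L.bracket v w ∈ U)
    {k l : ℕ} {x y : TmA L m} (hx : x ∈ filt L m S k) (hy : y ∈ filt L m T l) :
    brTm L m x y ∈ filt L m U (k + l) := by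
  have h1 : filt L m S k ≤ (filt L m U (k + l)).comap ((brTm L m).flip y) := by
    refine filt_le_iff.2 fun s hs μ hμ => ?_
    have h2 : filt L m T l ≤ (filt L m U (k + l)).comap (brTm L m (s ⊗ₜ μ)) := by
      refine filt_le_iff.2 fun t ht ν hν => ?_
      rw [Submodule.mem_comap, brTm_tmul]
      refine tmul_mem_filt (h s hs t ht) ?_
      rw [pow_add]
      exact Ideal.mul_mem_mul hμ hν
    exact h2 hy
  exact h1 hx

theorem dTm_dTm (x : TmA L m) : dTm L m (dTm L m x) = 0 := by
  induction x using TensorProduct.induction_on with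
  | zero => simp
  | tmul s μ => simp [dTm_tmul, L.d_sq]
  | add x y hx hy => simp [hx, hy]

theorem idealMul_comm (μ ν : m) : idealMul (K := K) m μ ν = idealMul (K := K) m ν μ :=
  Subtype.ext (mul_comm _ _)

theorem idealMul_assoc (μ ν ρ : m) : idealMul (K := K) m μ (idealMul (K := K) m ν ρ) =
    idealMul (K := K) m (idealMul (K := K) m μ ν) ρ :=
  Subtype.ext (mul_assoc _ _ _).symm

theorem dTm_brTm {k : ℕ} {a : TmA L m} (ha : a ∈ filt L m (L.grading 0) k) (w : TmA L m) :
    dTm L m (brTm L m a w) = brTm L m (dTm L m a) w + brTm L m a (dTm L m w) := by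
  have h : filt L m (L.grading 0) k ≤ LinearMap.eqLocus ((dTm L m) ∘ₗ (brTm L m).flip w)
      ((brTm L m).flip w ∘ₗ dTm L m + (brTm L m).flip (dTm L m w)) := by
    refine filt_le_iff.2 fun s hs μ _ => ?_
    change dTm L m (brTm L m (s ⊗ₜ μ) w) =
      brTm L m (dTm L m (s ⊗ₜ μ)) w + brTm L m (s ⊗ₜ μ) (dTm L m w)
    induction w using TensorProduct.induction_on with
    | zero => simp
    | tmul t ν => simp [dTm_tmul, brTm_tmul, L.leibniz 0 s t hs, TensorProduct.add_tmul]
    | add x y hx hy => simp only [map_add, hx, hy]; abel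
  exact h ha

theorem brTm_comm {k l : ℕ} {v w : TmA L m} (hv : v ∈ filt L m (L.grading 1) k)
    (hw : w ∈ filt L m (L.grading 1) l) : brTm L m v w = brTm L m w v := by
  have h : filt L m (L.grading 1) k ≤
      LinearMap.eqLocus ((brTm L m).flip w) (brTm L m w) := by
    refine filt_le_iff.2 fun s hs μ _ => ?_
    have h' : filt L m (L.grading 1) l ≤
        LinearMap.eqLocus (brTm L m (s ⊗ₜ μ)) ((brTm L m).flip (s ⊗ₜ μ)) := by
      refine filt_le_iff.2 fun t ht ν _ => ?_
      change brTm L m (s ⊗ₜ μ) (t ⊗ₜ ν) = brTm L m (t ⊗ₜ ν) (s ⊗ₜ μ)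
      rw [brTm_tmul, brTm_tmul, L.antisymm 1 1 s t hs ht, idealMul_comm]
      simp
    exact h' hw
  exact h hv

theorem brTm_brTm {k l : ℕ} {a w : TmA L m} (ha : a ∈ filt L m (L.grading 0) k)
    (hw : w ∈ filt L m (L.grading 1) l) (u : TmA L m) :
    brTm L m a (brTm L m w u) = brTm L m (brTm L m a w) u + brTm L m w (brTm L m a u) := by
  have h : filt L m (L.grading 0) k ≤ LinearMap.eqLocus ((brTm L m).flip (brTm L m w u))
      ((brTm L m).flip u ∘ₗ (brTm L m).flip w + brTm L m w ∘ₗ (brTm L m).flip u) := by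
    refine filt_le_iff.2 fun s hs μ _ => ?_
    have h' : filt L m (L.grading 1) l ≤ LinearMap.eqLocus
        (brTm L m (s ⊗ₜ μ) ∘ₗ (brTm L m).flip u)
        ((brTm L m).flip u ∘ₗ brTm L m (s ⊗ₜ μ) +
          (brTm L m).flip (brTm L m (s ⊗ₜ μ) u)) := by
      refine filt_le_iff.2 fun t ht ν _ => ?_
      change brTm L m (s ⊗ₜ μ) (brTm L m (t ⊗ₜ ν) u) =
        brTm L m (brTm L m (s ⊗ₜ μ) (t ⊗ₜ ν)) u + brTm L m (t ⊗ₜ ν) (brTm L m (s ⊗ₜ μ) u)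
      induction u using TensorProduct.induction_on with
      | zero => simp
      | tmul r ρ =>
        simp only [brTm_tmul, L.jacobi 0 1 s t r hs ht, TensorProduct.add_tmul, idealMul_assoc,
          idealMul_comm ν μ]
        simp
      | add x y hx hy => simp only [map_add, hx, hy]; abel
    exact h' hw
  exact h ha

theorem brTm_mem_grading {i j : ℤ} {k l : ℕ} {x y : TmA L m}
    (hx : x ∈ filt L m (L.grading i) k) (hy : y ∈ filt L m (L.grading j) l) :
    brTm L m x y ∈ filt L m (L.grading (i + j)) (k + l) :=
  brTm_mem_filt (fun v hv w hw => L.bracket_mem i j v w hv hw) hx hy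

theorem brTm_zero_one_mem {k l n : ℕ} {x y : TmA L m} (hx : x ∈ filt L m (L.grading 0) k)
    (hy : y ∈ filt L m (L.grading 1) l) (hn : n ≤ k + l) :
    brTm L m x y ∈ filt L m (L.grading 1) n :=
  filt_mono (by simp) hn (brTm_mem_grading hx hy)

theorem dTm_mem_grading {i : ℤ} {k : ℕ} {x : TmA L m} (hx : x ∈ filt L m (L.grading i) k) :
    dTm L m x ∈ filt L m (L.grading (i + 1)) k :=
  rTensor_mem_filt (L.d_mem i) hx

theorem dTm_zero_mem {k n : ℕ} {x : TmA L m} (hx : x ∈ filt L m (L.grading 0) k) (hn : n ≤ k) :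
    dTm L m x ∈ filt L m (L.grading 1) n :=
  filt_mono (by simp) hn (dTm_mem_grading hx)

theorem brTm_pow_mem {a y : TmA L m} (ha : a ∈ filt L m (L.grading 0) 1)
    (hy : y ∈ filt L m (L.grading 1) 1) (n : ℕ) :
    (brTm L m a ^ n) y ∈ filt L m (L.grading 1) 1 := by
  induction n with
  | zero => simpa
  | succ n ih =>
    rw [pow_succ', Module.End.mul_apply]
    exact brTm_zero_one_mem ha ih (by omega)

theorem gaugeTm_mem (n : ℕ) {a y : TmA L m} (ha : a ∈ filt L m (L.grading 0) 1)
    (hy : y ∈ filt L m (L.grading 1) 1) : gaugeTm L m n a y ∈ filt L m (L.grading 1) 1 := by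
  refine add_mem hy (sum_mem fun i _ => Submodule.smul_mem _ _ (brTm_pow_mem ha ?_ i))
  exact sub_mem (brTm_zero_one_mem ha hy (by omega)) (dTm_zero_mem ha le_rfl)

theorem brTm_sub_brTm_mem {k : ℕ} {a a' y y' : TmA L m} (ha : a ∈ filt L m (L.grading 0) 1)
    (hy' : y' ∈ filt L m (L.grading 1) 1)
    (haa : a - a' ∈ filt L m (L.grading 0) k) (hyy : y - y' ∈ filt L m (L.grading 1) k) :
    brTm L m a y - brTm L m a' y' ∈ filt L m (L.grading 1) (k + 1) := by
  have h : brTm L m a y - brTm L m a' y' =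
      brTm L m a (y - y') + brTm L m (a - a') y' := by
    simp
  rw [h]
  exact add_mem (brTm_zero_one_mem ha hyy (by omega)) (brTm_zero_one_mem haa hy' le_rfl)

theorem brTm_pow_sub_mem {k : ℕ} {a a' y y' : TmA L m} (ha : a ∈ filt L m (L.grading 0) 1)
    (ha' : a' ∈ filt L m (L.grading 0) 1) (hy' : y' ∈ filt L m (L.grading 1) 1)
    (haa : a - a' ∈ filt L m (L.grading 0) k) (hyy : y - y' ∈ filt L m (L.grading 1) k) (n : ℕ) :
    (brTm L m a ^ (n + 1)) y - (brTm L m a' ^ (n + 1)) y' ∈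
      filt L m (L.grading 1) (k + 1) := by
  induction n with
  | zero => simpa using brTm_sub_brTm_mem ha hy' haa hyy
  | succ n ih =>
    rw [pow_succ', pow_succ' _ (n + 1), Module.End.mul_apply, Module.End.mul_apply]
    exact brTm_sub_brTm_mem ha (brTm_pow_mem ha' hy' _) haa (filt_mono le_rfl (by omega) ih)

/-- The gauge action agrees with its linear part `y - da` to leading order. -/
theorem gaugeTm_sub_gaugeTm_mem {n k : ℕ} (hn : 0 < n) {a a' y y' : TmA L m}
    (ha : a ∈ filt L m (L.grading 0) 1) (ha' : a' ∈ filt L m (L.grading 0) 1)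
    (hy' : y' ∈ filt L m (L.grading 1) 1)
    (haa : a - a' ∈ filt L m (L.grading 0) k) (hyy : y - y' ∈ filt L m (L.grading 1) k) :
    gaugeTm L m n a y - gaugeTm L m n a' y' - ((y - y') - dTm L m (a - a')) ∈
      filt L m (L.grading 1) (k + 1) := by
  obtain ⟨n, rfl⟩ := Nat.exists_eq_add_of_lt hn
  have hbr := brTm_sub_brTm_mem ha hy' haa hyy
  have hlin : (brTm L m a y - dTm L m a) - (brTm L m a' y' - dTm L m a') ∈
      filt L m (L.grading 1) k := by
    have h : (brTm L m a y - dTm L m a) - (brTm L m a' y' - dTm L m a') =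
        (brTm L m a y - brTm L m a' y') - dTm L m (a - a') := by
      rw [map_sub]; abel
    rw [h]
    exact sub_mem (filt_mono le_rfl (by omega) hbr) (dTm_zero_mem haa le_rfl)
  have hlin' : brTm L m a' y' - dTm L m a' ∈ filt L m (L.grading 1) 1 :=
    sub_mem (brTm_zero_one_mem ha' hy' (by omega)) (dTm_zero_mem ha' le_rfl)
  have hsum := sum_mem (t := Finset.range n) fun i _ =>
    Submodule.smul_mem (filt L m (L.grading 1) (k + 1)) ((Nat.factorial (i + 1 + 1) : K))⁻¹
      (brTm_pow_sub_mem ha ha' hlin' haa hlin i)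
  convert add_mem hsum hbr using 1
  simp only [gaugeTm, zero_add, Finset.sum_range_succ', smul_sub, Finset.sum_sub_distrib, map_sub,
    pow_zero, Nat.factorial_one, Nat.cast_one, inv_one, one_smul, Module.End.one_apply]
  abel

/-- Only Maurer-Cartan elements are gauge equivalent to Maurer-Cartan elements. -/
theorem MCeq.of_gaugeTm [CharZero K] {n : ℕ} (hm : m ^ n = ⊥) {a y : TmA L m}
    (ha : a ∈ filt L m (L.grading 0) 1) (hy : y ∈ filt L m (L.grading 1) 1)
    (h : MCeq L m (gaugeTm L m n a y)) : MCeq L m y := by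
  let S := filt L m (L.grading 1) 1
  let T : Module.End K (TmA L m) := brTm L m a
  have hTS : ∀ x ∈ S, T x ∈ S := fun x hx => brTm_zero_one_mem ha hx (by omega)
  let N : Module.End K (S × K) := LinearMap.prod (LinearMap.coprod (T.restrict hTS)
    (-LinearMap.toSpanSingleton K S ⟨dTm L m a, dTm_zero_mem ha le_rfl⟩)) 0
  have hN1 (p : S × K) : ((N p).1 : TmA L m) = T p.1 - p.2 • dTm L m a := by
    simp [N, sub_eq_add_neg]
  have hN2 (p : S × K) : (N p).2 = 0 := rfl
  have hNpow (i : ℕ) (p : S × K) :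
      (((N ^ (i + 1)) p).1 : TmA L m) = (T ^ i) (T p.1 - p.2 • dTm L m a) ∧
        ((N ^ (i + 1)) p).2 = 0 := by
    induction i with
    | zero => simp [hN1, hN2]
    | succ i ih =>
      rw [pow_succ', Module.End.mul_apply]
      refine ⟨?_, hN2 _⟩
      rw [hN1, ih.1, ih.2, zero_smul, sub_zero, pow_succ' T, Module.End.mul_apply]
  have hTpow (i : ℕ) (x : TmA L m) : (T ^ i) x ∈ filt L m ⊤ i := by
    have hx : x ∈ filt L m ⊤ 1 := filt_top_one (L := L) (m := m) ▸ Submodule.mem_top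
    induction i with
    | zero => exact filt_mono le_rfl (by omega) hx
    | succ i ih =>
      rw [pow_succ', Module.End.mul_apply]
      exact filt_mono le_rfl (by omega)
        (brTm_mem_filt (U := ⊤) (fun _ _ _ _ => Submodule.mem_top) ha ih)
  have hT0 : T ^ n = 0 := by
    refine LinearMap.ext fun x => ?_
    simpa [filt_eq_bot hm] using hTpow n x
  have hN0 : N ^ (n + 1) = 0 := by
    refine LinearMap.ext fun p => Prod.ext (Subtype.ext ?_) (hNpow n p).2
    rw [(hNpow n p).1, hT0]
    rfl
  let B : (S × K) →ₗ[K] (S × K) →ₗ[K] TmA L m := LinearMap.mk₂ K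
    (fun p q => brTm L m p.1 q.1 + q.2 • dTm L m p.1 + p.2 • dTm L m q.1)
    (by intros; simp [add_smul]; abel)
    (by intros; simp [smul_smul, mul_comm])
    (by intros; simp [add_smul]; abel)
    (by intros; simp [smul_smul, mul_comm])
  have hBapp (p q : S × K) :
      B p q = brTm L m p.1 q.1 + q.2 • dTm L m p.1 + p.2 • dTm L m q.1 := rfl
  have hB (p q : S × K) : T (B p q) = B (N p) q + B p (N q) := by
    have hc := brTm_comm p.1.2 (dTm_zero_mem ha le_rfl)
    rw [hBapp, hBapp, hBapp, hN1, hN1, hN2, hN2]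
    simp only [T, map_add, map_sub, map_smul, LinearMap.sub_apply, LinearMap.smul_apply,
      brTm_brTm ha p.1.2, dTm_brTm ha, dTm_dTm, hc, zero_smul, smul_zero]
    module
  have hBMC (p : S × K) (hp : p.2 = 1) : B p p = 0 ↔ MCeq L m p.1 := by
    have : B p p = (2 : K) • (dTm L m p.1 + (2⁻¹ : K) • brTm L m p.1 p.1) := by
      rw [hBapp, hp, smul_add, smul_smul, mul_inv_cancel₀ two_ne_zero, two_smul, one_smul, one_smul]
      abel
    rw [this, smul_eq_zero_iff_right two_ne_zero, MCeq]
  let E : S × K := ∑ i ∈ Finset.range (n + 1), ((Nat.factorial i : K))⁻¹ • (N ^ i) (⟨y, hy⟩, 1)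
  have hE1 : (E.1 : TmA L m) = gaugeTm L m n a y := by
    simp only [E, Finset.sum_range_succ', Prod.fst_add, Prod.fst_sum, Submodule.coe_add,
      Submodule.coe_sum, Prod.smul_fst, Submodule.coe_smul, hNpow]
    simp [gaugeTm, T, add_comm]
  have hE2 : E.2 = 1 := by
    simp only [E, Finset.sum_range_succ', Prod.snd_add, Prod.snd_sum, Prod.smul_snd, hNpow]
    simp
  refine (hBMC (⟨y, hy⟩, 1) rfl).1 (bilin_eq_zero_of_exp_eq_zero B N T hB (n + 1) hN0
    (by rw [pow_succ, hT0, zero_mul]) _ ((hBMC E hE2).2 ?_))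
  rwa [hE1]

theorem exists_add_add_dTm_of_mem_filt {S M C C' : Submodule K L.V}
    (h : ∀ v ∈ S, ∃ x ∈ M, ∃ u ∈ C, ∃ c ∈ C', v = x + u + L.d c) {k : ℕ} {r : TmA L m}
    (hr : r ∈ filt L m S k) :
    ∃ x ∈ filt L m M k, ∃ u ∈ filt L m C k, ∃ c ∈ filt L m C' k, r = x + u + dTm L m c := by
  have hle : filt L m S k ≤
      filt L m M k ⊔ filt L m C k ⊔ (filt L m C' k).map (dTm L m) := by
    refine filt_le_iff.2 fun s hs μ hμ => ?_
    obtain ⟨x, hx, u, hu, c, hc, rfl⟩ := h s hs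
    rw [TensorProduct.add_tmul, TensorProduct.add_tmul]
    exact Submodule.add_mem_sup
      (Submodule.add_mem_sup (tmul_mem_filt hx hμ) (tmul_mem_filt hu hμ))
      ⟨_, tmul_mem_filt hc hμ, dTm_tmul _ _⟩
  obtain ⟨_, ht, _, ⟨c, hc, rfl⟩, rfl⟩ := Submodule.mem_sup.1 (hle hr)
  obtain ⟨x, hx, u, hu, rfl⟩ := Submodule.mem_sup.1 ht
  exact ⟨x, hx, u, hu, c, hc, rfl⟩

theorem rTensor_eq_zero_of_mem_filt {S : Submodule K L.V} {f : L.V →ₗ[K] L.V}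
    (h : ∀ v ∈ S, f v = 0) {k : ℕ} {x : TmA L m} (hx : x ∈ filt L m S k) :
    f.rTensor m x = 0 := by
  have hle : filt L m S k ≤ LinearMap.ker (f.rTensor m) :=
    filt_le_iff.2 fun s hs μ _ => by simp [h s hs]
  exact hle hx

theorem rTensor_dTm_of_mem_filt {S : Submodule K L.V} {f : L.V →ₗ[K] L.V}
    (h : ∀ v ∈ S, f (L.d v) = v) {k : ℕ} {x : TmA L m} (hx : x ∈ filt L m S k) :
    f.rTensor m (dTm L m x) = x := by
  have hle : filt L m S k ≤ LinearMap.eqLocus (f.rTensor m ∘ₗ dTm L m) LinearMap.id :=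
    filt_le_iff.2 fun s hs μ _ => by simp [dTm_tmul, h s hs]
  exact hle hx

theorem exists_gaugeTm_eq {M C C' : Submodule K L.V} (hM : M ≤ L.grading 1)
    (hC : C ≤ L.grading 1) (hC' : C' ≤ L.grading 0)
    (h : ∀ v ∈ L.grading 1, ∃ x ∈ M, ∃ u ∈ C, ∃ c ∈ C', v = x + u + L.d c)
    {n : ℕ} (hn : 0 < n) (hm : m ^ n = ⊥) {y : TmA L m} (hy : y ∈ filt L m (L.grading 1) 1) :
    ∃ x ∈ filt L m M 1, ∃ u ∈ filt L m C 1, ∃ c ∈ filt L m C' 1,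
      gaugeTm L m n c (x + u) = y := by
  have approx (k : ℕ) : ∃ x ∈ filt L m M 1, ∃ u ∈ filt L m C 1, ∃ c ∈ filt L m C' 1,
      y - gaugeTm L m n c (x + u) ∈ filt L m (L.grading 1) (k + 1) := by
    induction k with
    | zero =>
      refine ⟨0, zero_mem _, 0, zero_mem _, 0, zero_mem _, sub_mem hy (gaugeTm_mem n ?_ ?_)⟩
      · exact zero_mem _
      · simp
    | succ k ih =>
      obtain ⟨x, hx, u, hu, c, hc, hr⟩ := ih
      obtain ⟨x', hx', u', hu', c', hc', hr'⟩ := exists_add_add_dTm_of_mem_filt h hr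
      have h1 {S : Submodule K L.V} : filt L m S (k + 1) ≤ filt L m S 1 :=
        filt_mono le_rfl (by omega)
      refine ⟨x + x', add_mem hx (h1 hx'), u + u', add_mem hu (h1 hu'), c - c',
        sub_mem hc (h1 hc'), ?_⟩
      have key := gaugeTm_sub_gaugeTm_mem (k := k + 1) (a := c - c') (a' := c)
        (y := x + x' + (u + u')) (y' := x + u) hn
        (filt_mono hC' le_rfl (sub_mem hc (h1 hc'))) (filt_mono hC' le_rfl hc)
        (add_mem (filt_mono hM le_rfl hx) (filt_mono hC le_rfl hu))
        (by simpa using filt_mono hC' le_rfl hc')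
        (by
          convert add_mem (filt_mono hM le_rfl hx') (filt_mono hC le_rfl hu') using 1
          abel)
      convert neg_mem key using 1
      rw [eq_add_of_sub_eq hr']
      simp only [map_sub]
      abel
  obtain ⟨x, hx, u, hu, c, hc, hr⟩ := approx n
  refine ⟨x, hx, u, hu, c, hc, ?_⟩
  rw [filt_eq_bot (by rw [pow_succ, hm, Ideal.bot_mul]), Submodule.mem_bot, sub_eq_zero] at hr
  exact hr.symm

theorem gaugeTm_injective {M C : Submodule K L.V} (hM : M ≤ L.grading 1)
    (hC : C ≤ L.grading 0) {s : L.V →ₗ[K] L.V} (hsM : ∀ x ∈ M, s x = 0)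
    (hsC : ∀ c ∈ C, s (L.d c) = c) (hs : ∀ v ∈ L.grading 1, s v ∈ L.grading 0)
    {n : ℕ} (hn : 0 < n) (hm : m ^ n = ⊥) {x x' c c' : TmA L m} (hx : x ∈ filt L m M 1)
    (hx' : x' ∈ filt L m M 1) (hc : c ∈ filt L m C 1) (hc' : c' ∈ filt L m C 1)
    (h : gaugeTm L m n c x = gaugeTm L m n c' x') : x = x' ∧ c = c' := by
  have approx (k : ℕ) : x - x' ∈ filt L m (L.grading 1) (k + 1) ∧
      c - c' ∈ filt L m (L.grading 0) (k + 1) := by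
    induction k with
    | zero => exact ⟨filt_mono hM le_rfl (sub_mem hx hx'), filt_mono hC le_rfl (sub_mem hc hc')⟩
    | succ k ih =>
      have key := gaugeTm_sub_gaugeTm_mem hn (filt_mono hC le_rfl hc) (filt_mono hC le_rfl hc')
        (filt_mono hM le_rfl hx') ih.2 ih.1
      rw [h, sub_self, zero_sub, neg_sub] at key
      have hcc := rTensor_mem_filt hs key
      rw [map_sub, rTensor_dTm_of_mem_filt hsC (sub_mem hc hc'),
        rTensor_eq_zero_of_mem_filt hsM (sub_mem hx hx'), sub_zero] at hcc
      refine ⟨?_, hcc⟩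
      convert sub_mem (dTm_zero_mem hcc le_rfl) key using 1
      abel
  have hbot : m ^ (n + 1) = ⊥ := by rw [pow_succ, hm, Ideal.bot_mul]
  have hfin := approx n
  simpa [filt_eq_bot hbot, sub_eq_zero] using hfin

theorem eq_zero_of_MCeq_add {M M' C : Submodule K L.V} (hdM : ∀ x ∈ M, L.d x ∈ M')
    (hbrM : ∀ x ∈ M, ∀ x' ∈ M, L.bracket x x' ∈ M')
    {s : L.V →ₗ[K] L.V} (hsM : ∀ x ∈ M', s x = 0) (hsC : ∀ c ∈ C, s (L.d c) = c)
    {n : ℕ} (hm : m ^ n = ⊥) {x u : TmA L m} (hx : x ∈ filt L m M 1) (hu : u ∈ filt L m C 1)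
    (h : MCeq L m (x + u)) : u = 0 := by
  have approx (k : ℕ) : u ∈ filt L m ⊤ (k + 1) := by
    induction k with
    | zero => exact filt_mono le_top le_rfl hu
    | succ k ih =>
      have htop {k l : ℕ} {v w : TmA L m} (hv : v ∈ filt L m ⊤ k) (hw : w ∈ filt L m ⊤ l) :
          brTm L m v w ∈ filt L m ⊤ (k + l) :=
        brTm_mem_filt (fun _ _ _ _ => Submodule.mem_top) hv hw
      have hxt : x ∈ filt L m ⊤ 1 := filt_mono le_top le_rfl hx
      have hut : u ∈ filt L m ⊤ 1 := filt_mono le_top le_rfl hu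
      have hF : dTm L m x + (2⁻¹ : K) • brTm L m x x ∈ filt L m M' 1 :=
        add_mem (rTensor_mem_filt hdM hx)
          (Submodule.smul_mem _ _ (filt_mono le_rfl (by omega) (brTm_mem_filt hbrM hx hx)))
      have hR : (2⁻¹ : K) • (brTm L m x u + brTm L m u x + brTm L m u u) ∈
          filt L m ⊤ (k + 1 + 1) :=
        Submodule.smul_mem _ _ (add_mem (add_mem (filt_mono le_rfl (by omega) (htop hxt ih))
          (htop ih hxt)) (htop ih hut))
      have hsum : dTm L m u + (dTm L m x + (2⁻¹ : K) • brTm L m x x) +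
          (2⁻¹ : K) • (brTm L m x u + brTm L m u x + brTm L m u u) = 0 := by
        rw [← h]
        simp only [map_add, LinearMap.add_apply, smul_add]
        abel
      have hs := congrArg (s.rTensor m) hsum
      rw [map_add, map_add, rTensor_dTm_of_mem_filt hsC hu, rTensor_eq_zero_of_mem_filt hsM hF,
        add_zero, map_zero] at hs
      rw [eq_neg_of_add_eq_zero_left hs]
      exact neg_mem (rTensor_mem_filt (fun _ _ => Submodule.mem_top) hR)
  simpa [filt_eq_bot (show m ^ (n + 1) = ⊥ by rw [pow_succ, hm, Ideal.bot_mul])] using approx n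

end Filtration

/-- let `L = M ⊕ C ⊕ D` be a DGLA decomposed as graded vector
spaces, with `M` a differential graded Lie subalgebra and `d : C → D[1]` an
isomorphism of graded vector spaces.  Then for every local Artinian `K`-algebra
`A` with residue field `K` (whose maximal ideal `𝔪_A` is nilpotent,
`𝔪_A^nN = 0`), the map `α : MC_M(A) × (C⁰ ⊗ 𝔪_A) → MC_L(A)`,
`(x,c) ↦ e^c ∗ x`, is a bijection (stated as: every Maurer–Cartan element of
`L ⊗ 𝔪_A` has a unique preimage). -/
theorem gauge_normal_form_bijection
    (K : Type) [Field K] [CharZero K] (L : DGLA K)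
    (A : Type) [CommRing A] [Algebra K A] [IsArtinianRing A] [IsLocalRing A]
    (hres : Function.Bijective (algebraMap K (IsLocalRing.ResidueField A)))
    (nN : ℕ) (hm : (IsLocalRing.maximalIdeal A) ^ nN = ⊥)
    (Mg Cg Dg : ℤ → Submodule K L.V)
    (hMsub : ∀ i, Mg i ≤ L.grading i) (hCsub : ∀ i, Cg i ≤ L.grading i)
    (hDsub : ∀ i, Dg i ≤ L.grading i)
    (hspan : ∀ (i : ℤ) (v : L.V), v ∈ L.grading i →
      ∃ x ∈ Mg i, ∃ c ∈ Cg i, ∃ w ∈ Dg i, v = x + c + w)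
    (hindep : ∀ (i : ℤ) (x c w : L.V), x ∈ Mg i → c ∈ Cg i → w ∈ Dg i →
      x + c + w = 0 → x = 0 ∧ c = 0 ∧ w = 0)
    (hMd : ∀ (i : ℤ) (v : L.V), v ∈ Mg i → L.d v ∈ Mg (i + 1))
    (hMbr : ∀ (i j : ℤ) (v w : L.V), v ∈ Mg i → w ∈ Mg j →
      L.bracket v w ∈ Mg (i + j))
    (hCD : ∀ (i : ℤ) (v : L.V), v ∈ Cg i → L.d v ∈ Dg (i + 1))
    (hdinj : ∀ (i : ℤ) (v : L.V), v ∈ Cg i → L.d v = 0 → v = 0)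
    (hdsurj : ∀ (i : ℤ) (w : L.V), w ∈ Dg (i + 1) → ∃ c ∈ Cg i, L.d c = w) :
    ∀ y : TmA L (IsLocalRing.maximalIdeal A),
      y ∈ subTm L (IsLocalRing.maximalIdeal A) (L.grading 1) →
      MCeq L (IsLocalRing.maximalIdeal A) y →
      ∃! p : TmA L (IsLocalRing.maximalIdeal A) × TmA L (IsLocalRing.maximalIdeal A),
        p.1 ∈ subTm L (IsLocalRing.maximalIdeal A) (Mg 1) ∧
        MCeq L (IsLocalRing.maximalIdeal A) p.1 ∧
        p.2 ∈ subTm L (IsLocalRing.maximalIdeal A) (Cg 0) ∧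
        gaugeTm L (IsLocalRing.maximalIdeal A) nN p.2 p.1 = y := by
  have hn : 0 < nN := by
    rcases Nat.eq_zero_or_pos nN with rfl | hn
    · rw [pow_zero, Ideal.one_eq_top] at hm
      exact absurd hm top_ne_bot
    · exact hn
  have hindep' (i : ℤ) (x : L.V) (hx : x ∈ Mg (i + 1)) (c : L.V) (hc : c ∈ Cg (i + 1)) (c' : L.V)
      (hc' : c' ∈ Cg i) (h : x + c + L.d c' = 0) : x = 0 ∧ c = 0 ∧ c' = 0 := by
    obtain ⟨h1, h2, h3⟩ := hindep (i + 1) x c _ hx hc (hCD i c' hc') h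
    exact ⟨h1, h2, hdinj i c' hc' h3⟩
  have hspan' (v : L.V) (hv : v ∈ L.grading 1) :
      ∃ x ∈ Mg 1, ∃ u ∈ Cg 1, ∃ c ∈ Cg 0, v = x + u + L.d c := by
    obtain ⟨x, hx, u, hu, w, hw, rfl⟩ := hspan 1 v hv
    obtain ⟨c, hc, rfl⟩ := hdsurj 0 w (by simpa using hw)
    exact ⟨x, hx, u, hu, c, hc, rfl⟩
  obtain ⟨s, hsM, hsC, hs⟩ := exists_contraction L.d _ _ _ (hindep' 0)
  rw [zero_add] at hsM hsC
  obtain ⟨s', hsM', -, hs'⟩ := exists_contraction L.d _ _ _ (hindep' 1)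
  have hs0 (v : L.V) (hv : v ∈ L.grading 1) : s v ∈ L.grading 0 := by
    obtain ⟨x, hx, u, hu, c, hc, rfl⟩ := hspan' v hv
    rw [map_add, map_add, hsM x hx, hsC u hu, hs c hc, zero_add, zero_add]
    exact hCsub 0 hc
  intro y hy hMC
  simp only [subTm_eq_filt] at hy ⊢
  obtain ⟨x, hx, u, hu, c, hc, rfl⟩ :=
    exists_gaugeTm_eq (hMsub 1) (hCsub 1) (hCsub 0) hspan' hn hm hy
  have hxu := MCeq.of_gaugeTm hm (filt_mono (hCsub 0) le_rfl hc)
    (add_mem (filt_mono (hMsub 1) le_rfl hx) (filt_mono (hCsub 1) le_rfl hu)) hMC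
  obtain rfl := eq_zero_of_MCeq_add (hMd 1) (fun v hv w hw => hMbr 1 1 v w hv hw) hsM' hs' hm
    hx hu hxu
  rw [add_zero] at hxu ⊢
  refine ⟨(x, c), ⟨hx, hxu, hc, rfl⟩, ?_⟩
  rintro ⟨x', c'⟩ ⟨hx', -, hc', h⟩
  obtain ⟨rfl, rfl⟩ := gaugeTm_injective (hMsub 1) (hCsub 0) hsM hs hs0 hn hm hx' hx hc' hc h
  rfl
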